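/- arXiv:1008.3854 — 3 statements merged into one kernel-verified Lean document; each statement's English description precedes it below -/
import Mathlib

section
/- For every c ≥ 0, the function Ω_c is differentiable at every s with c−2 < 2s < c+2, with Ω_c′(s) = (2/π)·arcsin((c+2s)/(2√(1+2cs))); moreover, for c > 0 the shifted function Ω̃_c(z) = Ω_c(z + c/2) is twice differentiable on (−1,1) with Ω̃_c″(z) = 2(1+cz)/(π·(1+c²+2cz)·√(1−z²)). -/
open MeasureTheory Real Filter Topology
open scoped Classical

noncomputable section

/-- The function `h(c,s)` defining the curved part of the limit shape, for
`2s ∈ [c−2, c+2]` (with the continuous extension at `c = 0`). -/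
def hshape (c s : ℝ) : ℝ :=
  if c = 0 then (2/π) * (s * Real.arcsin s + Real.sqrt (1 - s^2))
  else (2/π) * (s * Real.arcsin ((2*s+c)/(2*Real.sqrt (1+2*s*c)))
      + (1/(2*c)) * Real.arccos ((2+2*s*c-c^2)/(2*Real.sqrt (1+2*s*c)))
      + (1/4) * Real.sqrt (4-(2*s-c)^2))

/-- Biane's limit shape `Ω_c`. -/
def Omega (c : ℝ) (s : ℝ) : ℝ :=
  if c ≤ 1 then (if c - 2 ≤ 2*s ∧ 2*s ≤ c + 2 then hshape c s else |s|)
  else if -(1/c) ≤ 2*s ∧ 2*s ≤ c - 2 then s + 1/c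
  else if c - 2 ≤ 2*s ∧ 2*s ≤ c + 2 then hshape c s else |s|

lemma aux_R {c z : ℝ} (hc : 0 ≤ c) (h1 : -1 < z) : 0 < 1 + c^2 + 2*c*z := by
  rcases hc.eq_or_lt with rfl | h
  · norm_num
  · nlinarith [sq_nonneg (1-c), mul_pos h (by linarith : 0 < 1 + z)]

lemma aux_sqrtR {c z : ℝ} (hc : 0 ≤ c) (h1 : -1 < z) :
    HasDerivAt (fun z : ℝ => √(1 + c^2 + 2*c*z)) (c / √(1 + c^2 + 2*c*z)) z := by
  have hR := aux_R hc h1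
  have h : HasDerivAt (fun z : ℝ => 1 + c^2 + 2*c*z) (2*c) z := by
    simpa using ((hasDerivAt_id z).const_mul (2*c)).const_add (1 + c^2)
  convert h.sqrt hR.ne' using 1
  field_simp

lemma aux_A {c z : ℝ} (hc : 0 ≤ c) (h1 : -1 < z) (h2 : z < 1) :
    HasDerivAt (fun z : ℝ => arcsin ((z + c) / √(1 + c^2 + 2*c*z)))
      ((1 + c*z) / ((1 + c^2 + 2*c*z) * √(1 - z^2))) z := by
  have hR := aux_R hc h1
  have hd := aux_sqrtR hc h1
  have hQ : 0 < 1 - z^2 := by nlinarith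
  have hr := Real.sqrt_pos.2 hR
  have hq := Real.sqrt_pos.2 hQ
  have hr2 := Real.sq_sqrt hR.le
  have hq2 := Real.sq_sqrt hQ.le
  have hn : HasDerivAt (fun z : ℝ => z + c) 1 z := (hasDerivAt_id z).add_const c
  have hA := hn.div hd hr.ne'
  have hs : 1 - ((z + c) / √(1 + c^2 + 2*c*z))^2 = (√(1 - z^2) / √(1 + c^2 + 2*c*z))^2 := by
    rw [div_pow, div_pow, hr2, hq2, one_sub_div hR.ne']
    congr 1
    ring
  have hpos : 0 < √(1 - z^2) / √(1 + c^2 + 2*c*z) := div_pos hq hr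
  have hlt : ((z + c) / √(1 + c^2 + 2*c*z))^2 < 1 := by nlinarith [pow_pos hpos 2]
  have hab := abs_lt.1 ((sq_lt_one_iff_abs_lt_one _).1 hlt)
  have := (Real.hasDerivAt_arcsin hab.1.ne' hab.2.ne).comp z hA
  rw [hs, Real.sqrt_sq hpos.le] at this
  refine this.congr_deriv ?_
  generalize √(1 + c^2 + 2*c*z) = r at *
  generalize √(1 - z^2) = q at *
  rw [← hr2]
  field_simp
  rw [hr2]
  ring

lemma aux_B {c z : ℝ} (hc : 0 < c) (h1 : -1 < z) (h2 : z < 1) :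
    HasDerivAt (fun z : ℝ => arccos ((1 + c*z) / √(1 + c^2 + 2*c*z)))
      (-(c*(c + z)) / ((1 + c^2 + 2*c*z) * √(1 - z^2))) z := by
  have hR := aux_R hc.le h1
  have hd := aux_sqrtR hc.le h1
  have hQ : 0 < 1 - z^2 := by nlinarith
  have hr := Real.sqrt_pos.2 hR
  have hq := Real.sqrt_pos.2 hQ
  have hr2 := Real.sq_sqrt hR.le
  have hq2 := Real.sq_sqrt hQ.le
  have hn : HasDerivAt (fun z : ℝ => 1 + c*z) c z := by
    simpa using ((hasDerivAt_id z).const_mul c).const_add 1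
  have hA := hn.div hd hr.ne'
  have hs : 1 - ((1 + c*z) / √(1 + c^2 + 2*c*z))^2
      = (c * √(1 - z^2) / √(1 + c^2 + 2*c*z))^2 := by
    rw [div_pow, div_pow, mul_pow, hr2, hq2, one_sub_div hR.ne']
    congr 1
    ring
  have hpos : 0 < c * √(1 - z^2) / √(1 + c^2 + 2*c*z) := div_pos (mul_pos hc hq) hr
  have hlt : ((1 + c*z) / √(1 + c^2 + 2*c*z))^2 < 1 := by nlinarith [pow_pos hpos 2]
  have hab := abs_lt.1 ((sq_lt_one_iff_abs_lt_one _).1 hlt)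
  have := (Real.hasDerivAt_arccos hab.1.ne' hab.2.ne).comp z hA
  rw [hs, Real.sqrt_sq hpos.le] at this
  refine this.congr_deriv ?_
  generalize √(1 + c^2 + 2*c*z) = r at *
  generalize √(1 - z^2) = q at *
  rw [← hr2]
  field_simp
  rw [hr2]
  ring

lemma aux_Q {z : ℝ} (h1 : -1 < z) (h2 : z < 1) :
    HasDerivAt (fun z : ℝ => √(1 - z^2)) (-z / √(1 - z^2)) z := by
  have hQ : 0 < 1 - z^2 := by nlinarith
  have h : HasDerivAt (fun z : ℝ => 1 - z^2) (-(2*z)) z := by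
    simpa using (hasDerivAt_pow 2 z).const_sub 1
  convert h.sqrt hQ.ne' using 1
  field_simp

lemma aux_h {c z : ℝ} (hc : 0 < c) :
    hshape c (z + c/2) = (2/π) * ((z + c/2) * arcsin ((z + c) / √(1 + c^2 + 2*c*z))
      + (1/(2*c)) * arccos ((1 + c*z) / √(1 + c^2 + 2*c*z)) + (1/2) * √(1 - z^2)) := by
  have e1 : 1 + 2*(z + c/2)*c = 1 + c^2 + 2*c*z := by ring
  have e2 : 4 - (2*(z + c/2) - c)^2 = 2^2 * (1 - z^2) := by ring
  have e3 : 2*(z + c/2) + c = 2*(z + c) := by ring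
  have e4 : 2 + 2*(z + c/2)*c - c^2 = 2*(1 + c*z) := by ring
  rw [hshape, if_neg hc.ne', e1, e2, e3, e4, Real.sqrt_mul (by norm_num),
    Real.sqrt_sq (by norm_num), mul_div_mul_left _ _ two_ne_zero, mul_div_mul_left _ _ two_ne_zero]
  ring

lemma aux_hd {c z : ℝ} (hc : 0 < c) (h1 : -1 < z) (h2 : z < 1) :
    HasDerivAt (fun z => hshape c (z + c/2))
      ((2/π) * arcsin ((z + c) / √(1 + c^2 + 2*c*z))) z := by
  have hR := aux_R hc.le h1
  have hQ : 0 < 1 - z^2 := by nlinarith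
  have hq := Real.sqrt_pos.2 hQ
  have hn : HasDerivAt (fun z : ℝ => z + c/2) 1 z := (hasDerivAt_id z).add_const _
  have := (((hn.mul (aux_A hc.le h1 h2)).add ((aux_B hc h1 h2).const_mul (1/(2*c)))).add
    ((aux_Q h1 h2).const_mul (1/2))).const_mul (2/π)
  have h := this.congr_of_eventuallyEq (f₁ := fun z => hshape c (z + c/2))
    (Eventually.of_forall fun z => aux_h hc)
  refine h.congr_deriv ?_
  congr 1
  generalize arcsin ((z + c) / √(1 + c^2 + 2*c*z)) = A
  generalize √(1 - z^2) = q at *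
  obtain ⟨R, hRe⟩ : ∃ R, R = 1 + c^2 + 2*c*z := ⟨_, rfl⟩
  rw [← hRe] at hR ⊢
  field_simp
  rw [hRe]
  ring

lemma aux_ev {c s : ℝ} (h1 : c - 2 < 2*s) (h2 : 2*s < c + 2) : Omega c =ᶠ[𝓝 s] hshape c := by
  have : ∀ᶠ t in 𝓝 s, t ∈ Set.Ioo ((c-2)/2) ((c+2)/2) :=
    Ioo_mem_nhds (by linarith) (by linarith)
  filter_upwards [this] with t ht
  have a : c - 2 < 2*t := by linarith [ht.1]
  have b : 2*t < c + 2 := by linarith [ht.2]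
  unfold Omega
  rw [if_pos (⟨a.le, b.le⟩ : c - 2 ≤ 2*t ∧ 2*t ≤ c + 2),
    if_neg (fun h => absurd h.2 (not_le.2 a) : ¬ (-(1/c) ≤ 2*t ∧ 2*t ≤ c - 2))]
  simp

lemma aux_first {c : ℝ} (hc : 0 ≤ c) (s : ℝ) (h1 : c - 2 < 2*s) (h2 : 2*s < c + 2) :
    HasDerivAt (Omega c) ((2/π) * Real.arcsin ((c+2*s)/(2*Real.sqrt (1+2*c*s)))) s := by
  refine HasDerivAt.congr_of_eventuallyEq ?_ (aux_ev h1 h2)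
  rcases hc.eq_or_lt with rfl | hc
  · have a : -1 < s := by linarith
    have b : s < 1 := by linarith
    have hq := Real.sqrt_pos.2 (by nlinarith : 0 < 1 - s^2)
    have h := (((hasDerivAt_id s).mul (Real.hasDerivAt_arcsin a.ne' b.ne)).add
      (aux_Q a b)).const_mul (2/π)
    have h := h.congr_of_eventuallyEq (f₁ := hshape 0)
      (Eventually.of_forall fun z => by simp [hshape])
    refine h.congr_deriv ?_
    simp
    field_simp
    ring
  · have a : -1 < s - c/2 := by linarith
    have b : s - c/2 < 1 := by linarith
    have h := (aux_hd hc a b).comp s ((hasDerivAt_id s).sub_const (c/2))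
    have h := h.congr_of_eventuallyEq (f₁ := hshape c)
      (Eventually.of_forall fun z => by simp)
    refine h.congr_deriv ?_
    have e1 : 1 + c^2 + 2*c*(s - c/2) = 1 + 2*c*s := by ring
    have e2 : c + 2*s = 2 * (s - c/2 + c) := by ring
    rw [e1, e2, mul_div_mul_left _ _ two_ne_zero, mul_one]

lemma aux_tilde {c z : ℝ} (hc : 0 < c) (h1 : -1 < z) (h2 : z < 1) :
    HasDerivAt (fun z => Omega c (z + c/2))
      ((2/π) * arcsin ((z + c) / √(1 + c^2 + 2*c*z))) z := by
  refine (aux_hd hc h1 h2).congr_of_eventuallyEq ?_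
  have ht : Tendsto (fun z : ℝ => z + c/2) (𝓝 z) (𝓝 (z + c/2)) :=
    (continuous_id.add continuous_const).tendsto z
  exact ht.eventually (aux_ev (by linarith) (by linarith))

/-- For `c ≥ 0`, `Ω_c` is differentiable at every `s` with
`c−2 < 2s < c+2`, with `Ω_c′(s) = (2/π)·arcsin((c+2s)/(2√(1+2cs)))`; moreover for
`c > 0` the shifted function `Ω̃_c(z) = Ω_c(z+c/2)` is twice differentiable on
`(−1,1)` with `Ω̃_c″(z) = 2(1+cz)/(π(1+c²+2cz)√(1−z²))`. -/
theorem Omega_deriv_and_second_deriv :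
    ∀ c : ℝ, 0 ≤ c →
      (∀ s : ℝ, c - 2 < 2*s → 2*s < c + 2 →
        HasDerivAt (Omega c) ((2/π) * Real.arcsin ((c+2*s)/(2*Real.sqrt (1+2*c*s)))) s) ∧
      (0 < c → ∀ z ∈ Set.Ioo (-1:ℝ) 1,
        DifferentiableAt ℝ (fun z => Omega c (z + c/2)) z ∧
        HasDerivAt (deriv (fun z => Omega c (z + c/2)))
          (2*(1+c*z)/(π*(1+c^2+2*c*z)*Real.sqrt (1-z^2))) z) := by
  intro c hc
  refine ⟨aux_first hc, fun hc z hz => ⟨(aux_tilde hc hz.1 hz.2).differentiableAt, ?_⟩⟩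
  have h := (aux_A hc.le hz.1 hz.2).const_mul (2/π)
  have he : deriv (fun z => Omega c (z + c/2)) =ᶠ[𝓝 z]
      fun z => (2/π) * arcsin ((z + c) / √(1 + c^2 + 2*c*z)) := by
    filter_upwards [Ioo_mem_nhds hz.1 hz.2] with t ht
    exact (aux_tilde hc ht.1 ht.2).deriv
  refine (h.congr_of_eventuallyEq he).congr_deriv ?_
  rw [div_mul_div_comm, mul_assoc π]
end
end

section
/- Let λ be a Young diagram with n cells and at most N rows. Then for every cell (i,j) ∈ λ one has h_{i,j} ≤ N + c_{i,λ_i+1−j}, and consequently Σ_{(i,j)∈λ} m(h_{i,j}) ≥ (1/2)·Σ_{(i,j)∈λ} m(N + c_{i,j}), i.e. θ̂(λ) ≥ ρ̂(λ). -/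
open MeasureTheory Real Filter Topology
open scoped Classical

noncomputable section

/-- Row lengths of a partition of `n`, `1`-indexed and weakly decreasing
(`rowLen lam i` is the length `λᵢ` of the `i`-th row; it is `0` for `i` beyond
the number of parts). -/
def rowLen {n : ℕ} (lam : Nat.Partition n) (i : ℕ) : ℕ :=
  ((lam.parts.sort (· ≤ ·)).reverse.getD (i - 1) 0)

/-- Column lengths, i.e. the conjugate partition `λ′ⱼ = #{i : λᵢ ≥ j}`. -/
def colLen {n : ℕ} (lam : Nat.Partition n) (j : ℕ) : ℕ :=
  ((Finset.Icc 1 n).filter (fun i => j ≤ rowLen lam i)).card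

/-- The cells `(i, j)` of the Young diagram of `lam`, with `1 ≤ i` and `1 ≤ j ≤ λᵢ`. -/
def cellsOf {n : ℕ} (lam : Nat.Partition n) : Finset (ℕ × ℕ) :=
  (Finset.Icc 1 n ×ˢ Finset.Icc 1 n).filter (fun p => p.2 ≤ rowLen lam p.1)

/-- The hook length `h_{i,j} = (λᵢ − j) + (λ′ⱼ − i) + 1` of the cell `(i,j)`. -/
def hookLen {n : ℕ} (lam : Nat.Partition n) (i j : ℕ) : ℕ :=
  (rowLen lam i - j) + (colLen lam j - i) + 1

/-- `𝕐_N^n`: Young diagrams with `n` cells and at most `N` rows. -/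
def YNN (n N : ℕ) : Finset (Nat.Partition n) :=
  Finset.univ.filter (fun lam => lam.parts.card ≤ N)

/-- `dim E_λ = n! · ∏ (N + c_{i,j}) / (∏ h_{i,j})²`, the dimension of the isotypic
component of `(ℂ^N)^{⊗n}` indexed by `λ` (here the content is `c_{i,j} = j − i`). -/
def dimE (n N : ℕ) (lam : Nat.Partition n) : ℝ :=
  (n.factorial : ℝ) * (∏ p ∈ cellsOf lam, ((N : ℝ) + (p.2 : ℝ) - (p.1 : ℝ))) /
    (∏ p ∈ cellsOf lam, (hookLen lam p.1 p.2 : ℝ))^2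

/-- The probability measure `ℙ_N^n(λ) = dim E_λ / N^n` on `𝕐_N^n`. -/
def PNN (n N : ℕ) (lam : Nat.Partition n) : ℝ := dimE n N lam / (N : ℝ)^n

/-- `m(x) = Σ_{k≥1} 1/(k(k+1)(2k+1)x^{2k})` (indexed here by `k = k'+1`, `k' : ℕ`). -/
def mfun (x : ℝ) : ℝ :=
  ∑' k : ℕ, 1 / (((k:ℝ)+1) * ((k:ℝ)+2) * (2*(k:ℝ)+3) * x^(2*(k+1)))

/-- `θ̂(λ) = (1/√n)·Σ_{(i,j)∈λ} m(h_{i,j})`. -/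
def thetaHat (n : ℕ) (lam : Nat.Partition n) : ℝ :=
  (1/Real.sqrt n) * ∑ p ∈ cellsOf lam, mfun (hookLen lam p.1 p.2 : ℝ)

/-- `ρ̂(λ) = (1/(2√n))·Σ_{(i,j)∈λ} m(N + c_{i,j})`. -/
def rhoHat (n N : ℕ) (lam : Nat.Partition n) : ℝ :=
  (1/(2*Real.sqrt n)) * ∑ p ∈ cellsOf lam, mfun ((N:ℝ) + (p.2:ℝ) - (p.1:ℝ))

lemma aux_rowLen_le {n : ℕ} (lam : Nat.Partition n) (i : ℕ) : rowLen lam i ≤ n := by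
  unfold rowLen
  by_cases h : i - 1 < (lam.parts.sort (· ≤ ·)).reverse.length
  · rw [List.getD_eq_getElem _ _ h]
    have hm := List.getElem_mem h
    have h2 : (lam.parts.sort (· ≤ ·)).reverse[i - 1] ∈ lam.parts := by
      rw [List.mem_reverse, Multiset.mem_sort] at hm
      exact hm
    have := Multiset.le_sum_of_mem h2
    rwa [lam.parts_sum] at this
  · rw [List.getD_eq_default _ _ (by omega)]
    exact Nat.zero_le _

lemma aux_idx {n : ℕ} (lam : Nat.Partition n) (i : ℕ) (hi : 1 ≤ i) (h : 1 ≤ rowLen lam i) :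
    i ≤ lam.parts.card := by
  unfold rowLen at h
  by_contra hc
  rw [List.getD_eq_default _ _ (by simp; omega)] at h
  omega

lemma aux_colLen {n : ℕ} (lam : Nat.Partition n) (j : ℕ) (hj : 1 ≤ j) :
    colLen lam j ≤ lam.parts.card := by
  unfold colLen
  have : (Finset.Icc 1 n).filter (fun i => j ≤ rowLen lam i) ⊆ Finset.Icc 1 lam.parts.card := by
    intro i hi
    simp only [Finset.mem_filter, Finset.mem_Icc] at hi ⊢
    exact ⟨hi.1.1, aux_idx lam i hi.1.1 (by omega)⟩
  simpa using Finset.card_le_card this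

lemma aux_summable (x : ℝ) (hx : 1 ≤ x) :
    Summable (fun k : ℕ => 1 / (((k:ℝ)+1) * ((k:ℝ)+2) * (2*(k:ℝ)+3) * x^(2*(k+1)))) := by
  have hs : Summable (fun k : ℕ => 1 / ((k:ℝ)+1)^2) := by
    have := (summable_nat_add_iff 1).2 (Real.summable_one_div_nat_pow.2 (by norm_num : 1 < 2))
    simpa using this
  refine Summable.of_nonneg_of_le (fun k => by positivity) (fun k => ?_) hs
  apply one_div_le_one_div_of_le (by positivity)
  have h1 : 1 ≤ x^(2*(k+1)) := one_le_pow₀ hx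
  have hk : (0:ℝ) ≤ k := Nat.cast_nonneg k
  calc ((k:ℝ)+1)^2 ≤ ((k:ℝ)+1) * ((k:ℝ)+2) * (2*(k:ℝ)+3) * 1 := by
        nlinarith [mul_nonneg hk hk, mul_nonneg hk (mul_nonneg hk hk)]
    _ ≤ _ := by gcongr

lemma aux_anti (x y : ℝ) (hx : 1 ≤ x) (hxy : x ≤ y) : mfun y ≤ mfun x := by
  unfold mfun
  refine Summable.tsum_le_tsum (fun k => ?_) (aux_summable y (hx.trans hxy)) (aux_summable x hx)
  apply one_div_le_one_div_of_le (by positivity)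
  gcongr

lemma aux_nonneg (x : ℝ) (hx : 1 ≤ x) : 0 ≤ mfun x :=
  tsum_nonneg (fun k => by positivity)

/-- For a Young diagram `λ` with `n` cells and at most `N` rows,
every cell `(i,j)` satisfies `h_{i,j} ≤ N + c_{i,λᵢ+1−j}`, and consequently
`Σ m(h_{i,j}) ≥ (1/2)·Σ m(N + c_{i,j})`, i.e. `θ̂(λ) ≥ ρ̂(λ)`. -/
theorem hook_le_shifted_content_and_thetaHat_ge_rhoHat :
    ∀ (n N : ℕ) (lam : Nat.Partition n), lam.parts.card ≤ N →
      (∀ p ∈ cellsOf lam,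
        (hookLen lam p.1 p.2 : ℤ) ≤
          (N : ℤ) + ((rowLen lam p.1 : ℤ) + 1 - (p.2 : ℤ)) - (p.1 : ℤ)) ∧
      (1/2) * (∑ p ∈ cellsOf lam, mfun ((N:ℝ) + (p.2:ℝ) - (p.1:ℝ))) ≤
        ∑ p ∈ cellsOf lam, mfun (hookLen lam p.1 p.2 : ℝ) ∧
      rhoHat n N lam ≤ thetaHat n lam := by
  intro n N lam hN
  have hook : ∀ p ∈ cellsOf lam, (hookLen lam p.1 p.2 : ℤ) ≤
      (N : ℤ) + ((rowLen lam p.1 : ℤ) + 1 - (p.2 : ℤ)) - (p.1 : ℤ) := by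
    intro p hp
    simp only [cellsOf, Finset.mem_filter, Finset.mem_product, Finset.mem_Icc] at hp
    have h1 := aux_colLen lam p.2 hp.1.2.1
    have h2 := aux_idx lam p.1 hp.1.1.1 (by omega)
    unfold hookLen
    omega
  have hre : ∑ p ∈ cellsOf lam, mfun ((N:ℝ) + (p.2:ℝ) - (p.1:ℝ)) =
      ∑ p ∈ cellsOf lam, mfun ((N:ℝ) + ((rowLen lam p.1 + 1 - p.2 : ℕ):ℝ) - (p.1:ℝ)) := by
    have hmem : ∀ p ∈ cellsOf lam, (p.1, rowLen lam p.1 + 1 - p.2) ∈ cellsOf lam := by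
      intro p hp
      have := aux_rowLen_le lam p.1
      simp only [cellsOf, Finset.mem_filter, Finset.mem_product, Finset.mem_Icc] at hp ⊢
      omega
    have hinv : ∀ p ∈ cellsOf lam,
        ((p.1, rowLen lam p.1 + 1 - (rowLen lam p.1 + 1 - p.2)) : ℕ × ℕ) = p := by
      intro p hp
      simp only [cellsOf, Finset.mem_filter, Finset.mem_product, Finset.mem_Icc] at hp
      ext
      · rfl
      · show rowLen lam p.1 + 1 - (rowLen lam p.1 + 1 - p.2) = p.2
        omega
    refine Finset.sum_bij' (fun p _ => (p.1, rowLen lam p.1 + 1 - p.2))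
      (fun p _ => (p.1, rowLen lam p.1 + 1 - p.2)) hmem hmem hinv hinv ?_
    intro p hp
    have := congrArg Prod.snd (hinv p hp)
    simp only at this
    simp only [this]
  have hle : ∑ p ∈ cellsOf lam, mfun ((N:ℝ) + (p.2:ℝ) - (p.1:ℝ)) ≤
      ∑ p ∈ cellsOf lam, mfun (hookLen lam p.1 p.2 : ℝ) := by
    rw [hre]
    apply Finset.sum_le_sum
    intro p hp
    have h := hook p hp
    simp only [cellsOf, Finset.mem_filter, Finset.mem_product, Finset.mem_Icc] at hp
    apply aux_anti
    · have : 1 ≤ hookLen lam p.1 p.2 := by unfold hookLen; omega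
      exact_mod_cast this
    · have h3 : (hookLen lam p.1 p.2 : ℤ) ≤
          (N : ℤ) + ((rowLen lam p.1 + 1 - p.2 : ℕ) : ℤ) - (p.1 : ℤ) := by omega
      exact_mod_cast h3
  have hnn : 0 ≤ ∑ p ∈ cellsOf lam, mfun ((N:ℝ) + (p.2:ℝ) - (p.1:ℝ)) := by
    apply Finset.sum_nonneg
    intro p hp
    simp only [cellsOf, Finset.mem_filter, Finset.mem_product, Finset.mem_Icc] at hp
    have h2 := aux_idx lam p.1 hp.1.1.1 (by omega)
    apply aux_nonneg
    have h3 : (1 : ℤ) ≤ (N : ℤ) + (p.2 : ℤ) - (p.1 : ℤ) := by omega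
    exact_mod_cast h3
  have hmain : (1/2) * (∑ p ∈ cellsOf lam, mfun ((N:ℝ) + (p.2:ℝ) - (p.1:ℝ))) ≤
        ∑ p ∈ cellsOf lam, mfun (hookLen lam p.1 p.2 : ℝ) := by linarith
  refine ⟨hook, hmain, ?_⟩
  unfold rhoHat thetaHat
  have e : (1/(2*Real.sqrt n)) = (1/Real.sqrt n) * (1/2) := by
    rw [mul_comm, one_div_mul_one_div]
  rw [e, mul_assoc]
  exact mul_le_mul_of_nonneg_left hmain (by positivity)
end
end

section
/- For all positive integers n and N: N^n = Σ_{λ ∈ 𝕐_N^n} n!·∏_{(i,j)∈λ}(N + c_{i,j}) / (∏_{(i,j)∈λ} h_{i,j})², where the sum is over all Young diagrams λ with n cells and at most N rows; in particular each summand is a positive integer and λ ↦ dim E_λ / N^n is a probability distribution on 𝕐_N^n. -/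
open MeasureTheory Real Filter Topology
open scoped Classical

noncomputable section

theorem syt_trace_aux {N : ℕ} (A M : Matrix (Fin N) (Fin N) ℝ) :
    ∑ i, (A.updateRow i ((A * M) i)).det = M.trace * A.det := by
  have h1 : ∀ i, (A.updateRow i ((A * M) i)).det = ((A * M) * A.adjugate) i i := by
    intro i
    rw [← Matrix.cramer_transpose_apply, Matrix.cramer_eq_adjugate_mulVec, Matrix.mul_apply,
      Matrix.mulVec, dotProduct]
    refine Finset.sum_congr rfl fun j _ => ?_
    rw [← Matrix.adjugate_transpose, Matrix.transpose_apply]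
    ring
  rw [Finset.sum_congr rfl fun i _ => h1 i]
  change Matrix.trace _ = _
  rw [Matrix.mul_assoc, Matrix.trace_mul_comm, Matrix.mul_assoc, Matrix.adjugate_mul]
  simp [mul_comm]

theorem syt_update {N : ℕ} (x : Fin N → ℝ) (i : Fin N) (y : ℝ) :
    Matrix.vandermonde (Function.update x i y) =
      (Matrix.vandermonde x).updateRow i (fun j => y ^ (j : ℕ)) := by
  ext a b
  by_cases h : a = i
  · subst h; simp [Matrix.vandermonde]
  · simp [Matrix.vandermonde, h]

theorem syt_b {N : ℕ} (x : Fin N → ℝ) (t : ℝ) :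
    ∑ i, (Matrix.vandermonde (Function.update x i (x i + t))).det =
      N * (Matrix.vandermonde x).det := by
  let M : Matrix (Fin N) (Fin N) ℝ :=
    fun k j => t ^ ((j : ℕ) - k) * ((j : ℕ).choose k : ℝ)
  have hM : M.trace = N := by simp [Matrix.trace, Matrix.diag, M]
  rw [← hM, ← syt_trace_aux]
  refine Finset.sum_congr rfl fun i _ => ?_
  rw [syt_update]
  congr 2
  ext j
  rw [Matrix.mul_apply, add_pow]
  simp only [Matrix.vandermonde_apply, M]
  rw [Fin.sum_univ_eq_sum_range (fun k => x i ^ k * (t ^ ((j : ℕ) - k) * ((j : ℕ).choose k : ℝ)))]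
  rw [← Finset.sum_subset (s₁ := Finset.range (j + 1)) (s₂ := Finset.range N)]
  · exact Finset.sum_congr rfl fun k _ => by ring
  · intro k hk
    have := j.2
    simp at hk ⊢; omega
  · intro k _ hk
    simp at hk
    rw [Nat.choose_eq_zero_of_lt (by omega)]; simp

theorem syt_a {N : ℕ} (x : Fin N → ℝ) (t : ℝ) :
    ∑ i, x i * (Matrix.vandermonde (Function.update x i (x i + t))).det =
      (∑ i, x i + t * ∑ i : Fin N, ((i : ℕ) : ℝ)) * (Matrix.vandermonde x).det := by
  let M : Matrix (Fin N) (Fin N) ℝ :=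
    fun k j => if (k : ℕ) = 0 then 0 else t ^ ((j : ℕ) + 1 - k) * ((j : ℕ).choose (k - 1) : ℝ) -
      (if (k : ℕ) = j + 1 then 1 else 0)
  have hM : M.trace = t * ∑ i : Fin N, ((i : ℕ) : ℝ) := by
    rw [Matrix.trace, Finset.mul_sum]
    refine Finset.sum_congr rfl fun i _ => ?_
    simp only [Matrix.diag, M]
    split_ifs with h h2
    · simp [h]
    · omega
    · obtain ⟨m, hm⟩ := Nat.exists_eq_succ_of_ne_zero h
      rw [hm]; simp
  rw [add_mul, ← hM, ← syt_trace_aux, Finset.sum_mul, ← Finset.sum_add_distrib]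
  refine Finset.sum_congr rfl fun i _ => ?_
  have e1 : (Matrix.vandermonde x).det = ((Matrix.vandermonde x).updateRow i
      (fun j => x i ^ (j : ℕ))).det := by
    rw [← syt_update, Function.update_eq_self]
  rw [e1, syt_update, ← Matrix.det_updateRow_smul, ← Matrix.det_updateRow_smul,
    ← Matrix.det_updateRow_add]
  congr 2
  ext j
  simp only [Pi.add_apply, Pi.smul_apply, smul_eq_mul]
  rw [Matrix.mul_apply, add_pow]
  simp only [Matrix.vandermonde_apply, M]
  rw [Fin.sum_univ_eq_sum_range (fun k => x i ^ k * (if k = 0 then 0 else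
    t ^ ((j : ℕ) + 1 - k) * ((j : ℕ).choose (k - 1) : ℝ) - (if k = (j : ℕ) + 1 then 1 else 0)))]
  rw [← Finset.sum_subset (s₁ := Finset.range (j + 1)) (s₂ := Finset.range N)]
  · rw [Finset.sum_range_succ, Finset.sum_range_succ', mul_add,
      Finset.mul_sum]
    have : ∀ k ∈ Finset.range (j : ℕ), x i ^ (k + 1) * (if k + 1 = 0 then 0 else
      t ^ ((j : ℕ) + 1 - (k + 1)) * ((j : ℕ).choose (k + 1 - 1) : ℝ) -
        (if k + 1 = (j : ℕ) + 1 then 1 else 0)) =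
        x i * (x i ^ k * t ^ ((j : ℕ) - k) * ((j : ℕ).choose k : ℝ)) := by
      intro k hk
      simp at hk
      rw [if_neg (by omega), if_neg (by omega)]
      simp only [Nat.add_sub_cancel, Nat.add_sub_add_right]
      ring
    rw [Finset.sum_congr rfl this]
    simp
    ring
  · intro k hk
    have := j.2
    simp at hk ⊢; omega
  · intro k _ hk
    simp at hk
    rw [if_neg (by omega)]
    by_cases h : k = (j : ℕ) + 1
    · subst h; simp
    · rw [if_neg h, Nat.choose_eq_zero_of_lt (by omega)]; simp

def sytD {N : ℕ} (l : Fin N → ℕ) : ℝ := (Matrix.vandermonde (fun i => -(l i : ℝ))).det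

def sytS (N n : ℕ) : Finset (Fin N → ℕ) :=
  (Finset.piAntidiag Finset.univ (n + ∑ i : Fin N, (i : ℕ))).filter StrictAnti

def sytF {N : ℕ} (n : ℕ) (l : Fin N → ℕ) : ℝ :=
  (n.factorial : ℝ) * sytD l / ∏ i, ((l i).factorial : ℝ)

def sytG {N : ℕ} (l : Fin N → ℕ) : ℝ := sytD l / ∏ i : Fin N, ((i : ℕ).factorial : ℝ)

theorem mem_sytS {N n : ℕ} (l : Fin N → ℕ) :
    l ∈ sytS N n ↔ (∑ i, l i = n + ∑ i : Fin N, (i : ℕ)) ∧ StrictAnti l := by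
  simp [sytS]

theorem sytD_prod {N : ℕ} (l : Fin N → ℕ) :
    sytD l = ∏ i, ∏ j ∈ Finset.Ioi i, ((l i : ℝ) - l j) := by
  rw [sytD, Matrix.det_vandermonde]
  refine Finset.prod_congr rfl fun i _ => Finset.prod_congr rfl fun j _ => by ring

theorem sytD_pos {N : ℕ} (l : Fin N → ℕ) (h : StrictAnti l) : 0 < sytD l := by
  rw [sytD_prod]
  refine Finset.prod_pos fun i _ => Finset.prod_pos fun j hj => ?_
  have := h (Finset.mem_Ioi.1 hj)
  rw [sub_pos]; exact_mod_cast this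

theorem sytD_inj {N : ℕ} (l : Fin N → ℕ) (h : sytD l ≠ 0) : Function.Injective l := by
  have := Matrix.det_vandermonde_ne_zero_iff.1 h
  intro a b hab
  exact this (by simp [hab])

theorem sytF_rec {N n : ℕ} (l : Fin N → ℕ) (h : ∑ i, l i = n + 1 + ∑ i : Fin N, (i : ℕ)) :
    sytF (n + 1) l =
      ∑ i, if l i = 0 then 0 else sytF n (Function.update l i (l i - 1)) := by
  have hP : (∏ i, ((l i).factorial : ℝ)) ≠ 0 :=
    Finset.prod_ne_zero_iff.2 fun i _ => by positivity
  have key : ∀ i, (if l i = 0 then 0 else sytF n (Function.update l i (l i - 1))) =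
      (-(n.factorial : ℝ) / ∏ i, ((l i).factorial : ℝ)) * (-(l i : ℝ) *
        (Matrix.vandermonde (Function.update (fun i => -(l i : ℝ)) i (-(l i : ℝ) + 1))).det) := by
    intro i
    split_ifs with h0
    · simp [h0]
    · have e1 : sytD (Function.update l i (l i - 1)) =
        (Matrix.vandermonde (Function.update (fun i => -(l i : ℝ)) i (-(l i : ℝ) + 1))).det := by
        rw [sytD]
        congr 2
        ext j
        by_cases hj : j = i
        · subst hj
          simp [Nat.cast_sub (Nat.one_le_iff_ne_zero.2 h0)]; ring
        · simp [hj]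
      have e2 : (∏ j, ((l j).factorial : ℝ)) =
          l i * ∏ j, ((Function.update l i (l i - 1) j).factorial : ℝ) := by
        rw [← Finset.mul_prod_erase _ _ (Finset.mem_univ i),
          ← Finset.mul_prod_erase _ (fun j => ((Function.update l i (l i - 1) j).factorial : ℝ))
            (Finset.mem_univ i), ← mul_assoc]
        congr 1
        · simp only [Function.update_self]
          rw [← Nat.mul_factorial_pred h0]; push_cast; ring
        · refine Finset.prod_congr rfl fun j hj => ?_
          rw [Function.update_of_ne (Finset.ne_of_mem_erase hj)]
      rw [e2] at hP
      rw [sytF, e1, e2]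
      have h1 := left_ne_zero_of_mul hP
      have h2 := right_ne_zero_of_mul hP
      field_simp
  rw [Finset.sum_congr rfl fun i _ => key i, ← Finset.mul_sum, syt_a (fun i => -(l i : ℝ)) 1]
  have h' : (∑ i, (l i : ℝ)) = n + 1 + ∑ i : Fin N, ((i : ℕ) : ℝ) := by exact_mod_cast h
  rw [Finset.sum_neg_distrib, h', sytF, sytD, Nat.factorial_succ]
  push_cast
  ring

theorem sytG_rec {N : ℕ} (l : Fin N → ℕ) :
    ∑ i, sytG (Function.update l i (l i + 1)) = N * sytG l := by
  have key : ∀ i, sytG (Function.update l i (l i + 1)) =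
      (Matrix.vandermonde (Function.update (fun i => -(l i : ℝ)) i (-(l i : ℝ) + (-1)))).det /
        ∏ i : Fin N, ((i : ℕ).factorial : ℝ) := by
    intro i
    rw [sytG, sytD]
    congr 3
    ext j
    by_cases hj : j = i
    · subst hj
      simp; ring
    · simp [hj]
  rw [Finset.sum_congr rfl fun i _ => key i, ← Finset.sum_div,
    syt_b (fun i => -(l i : ℝ)) (-1), sytG, sytD]
  ring

theorem syt_sum_update {N : ℕ} (l : Fin N → ℕ) (i : Fin N) (y : ℕ) :
    ∑ j, Function.update l i y j + l i = ∑ j, l j + y := by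
  rw [Finset.sum_update_of_mem (Finset.mem_univ i), Finset.sdiff_singleton_eq_erase,
    ← Finset.add_sum_erase _ l (Finset.mem_univ i)]
  ring

theorem syt_down {N : ℕ} (l : Fin N → ℕ) (i : Fin N) (hl : StrictAnti l)
    (h : sytD (Function.update l i (l i - 1)) ≠ 0) :
    StrictAnti (Function.update l i (l i - 1)) := by
  have hi := sytD_inj _ h
  refine Antitone.strictAnti_of_injective ?_ hi
  intro a b hab
  rcases hab.eq_or_lt with rfl | hab
  · exact le_rfl
  have := hl hab
  by_cases ha : a = i
  · subst ha
    rw [Function.update_self, Function.update_of_ne hab.ne']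
    omega
  · by_cases hb : b = i
    · subst hb
      rw [Function.update_self, Function.update_of_ne hab.ne]
      omega
    · rw [Function.update_of_ne ha, Function.update_of_ne hb]; omega

theorem syt_up {N : ℕ} (l : Fin N → ℕ) (i : Fin N) (hl : StrictAnti l)
    (h : sytD (Function.update l i (l i + 1)) ≠ 0) :
    StrictAnti (Function.update l i (l i + 1)) := by
  have hi := sytD_inj _ h
  refine Antitone.strictAnti_of_injective ?_ hi
  intro a b hab
  rcases hab.eq_or_lt with rfl | hab
  · exact le_rfl
  have := hl hab
  by_cases ha : a = i
  · subst ha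
    rw [Function.update_self, Function.update_of_ne hab.ne']
    omega
  · by_cases hb : b = i
    · subst hb
      rw [Function.update_self, Function.update_of_ne hab.ne]
      omega
    · rw [Function.update_of_ne ha, Function.update_of_ne hb]; omega

theorem syt_step (N n : ℕ) :
    ∑ l ∈ sytS N (n + 1), sytF (n + 1) l * sytG l = N * ∑ l ∈ sytS N n, sytF n l * sytG l := by
  have hL : ∑ l ∈ sytS N (n + 1), sytF (n + 1) l * sytG l =
      ∑ p ∈ sytS N (n + 1) ×ˢ (Finset.univ : Finset (Fin N)),
        (if p.1 p.2 = 0 then 0 else sytF n (Function.update p.1 p.2 (p.1 p.2 - 1))) * sytG p.1 := by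
    rw [Finset.sum_product]
    refine Finset.sum_congr rfl fun l hl => ?_
    rw [sytF_rec l ((mem_sytS l).1 hl).1, Finset.sum_mul]
  have hR : N * ∑ l ∈ sytS N n, sytF n l * sytG l =
      ∑ p ∈ sytS N n ×ˢ (Finset.univ : Finset (Fin N)),
        sytF n p.1 * sytG (Function.update p.1 p.2 (p.1 p.2 + 1)) := by
    rw [Finset.sum_product, Finset.mul_sum]
    refine Finset.sum_congr rfl fun l hl => ?_
    simp only
    rw [← Finset.mul_sum, sytG_rec]; ring
  rw [hL, hR]
  refine Finset.sum_bij_ne_zero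
    (fun p _ _ => (Function.update p.1 p.2 (p.1 p.2 - 1), p.2)) ?_ ?_ ?_ ?_
  · rintro ⟨l, i⟩ h1 h2
    simp only [Finset.mem_product, Finset.mem_univ, and_true] at h1 h2 ⊢
    rw [mem_sytS] at h1 ⊢
    have h3 := left_ne_zero_of_mul h2
    split_ifs at h3 with h0
    · exact absurd rfl h3
    have := syt_sum_update l i (l i - 1)
    refine ⟨by omega, syt_down l i h1.2 ?_⟩
    intro h4
    apply h3
    simp [sytF, h4]
  · rintro ⟨l, i⟩ h1 h2 ⟨l', i'⟩ h1' h2' h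
    simp only [Prod.mk.injEq] at h
    obtain ⟨h, rfl⟩ := h
    simp only [Prod.mk.injEq, and_true]
    have h3 := left_ne_zero_of_mul h2
    have h3' := left_ne_zero_of_mul h2'
    simp only at h3 h3'
    split_ifs at h3 with h0
    · exact absurd rfl h3
    split_ifs at h3' with h0'
    · exact absurd rfl h3'
    ext j
    have hj := congrFun h j
    by_cases e : j = i
    · subst e
      simp at hj; omega
    · simpa [e] using hj
  · rintro ⟨l, i⟩ h1 h2
    simp only [Finset.mem_product, Finset.mem_univ, and_true] at h1
    rw [mem_sytS] at h1
    have h3 : sytD (Function.update l i (l i + 1)) ≠ 0 := by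
      intro h4
      exact right_ne_zero_of_mul h2 (by simp [sytG, h4])
    refine ⟨(Function.update l i (l i + 1), i), ?_, ?_, ?_⟩
    · simp only [Finset.mem_product, Finset.mem_univ, and_true]
      rw [mem_sytS]
      have := syt_sum_update l i (l i + 1)
      exact ⟨by omega, syt_up l i h1.2 h3⟩
    · simpa using h2
    · simp
  · rintro ⟨l, i⟩ h1 h2
    have h3 := left_ne_zero_of_mul h2
    simp only at h3
    split_ifs at h3 with h0
    · exact absurd rfl h3
    have : l i - 1 + 1 = l i := by omega
    simp [h0, this]

def sytId (N : ℕ) : Fin N → ℕ := fun i => N - 1 - i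

theorem sytId_fac (N : ℕ) : ∏ i, ((sytId N i).factorial : ℝ) =
    ∏ i : Fin N, ((i : ℕ).factorial : ℝ) := by
  refine Fintype.prod_equiv Fin.revPerm _ _ fun i => ?_
  simp only [sytId, Fin.revPerm_apply, Fin.val_rev]
  congr 2; omega

theorem syt_sf (m : ℕ) : ∏ i : Fin (m + 1), ((i : ℕ).factorial : ℝ) = (m.superFactorial : ℝ) := by
  induction m with
  | zero => simp
  | succ m ih =>
    rw [Fin.prod_univ_castSucc, Nat.superFactorial_succ]
    simp only [Fin.val_castSucc, ih, Fin.val_last]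
    push_cast; ring

theorem sytD_id (N : ℕ) : sytD (sytId N) = ∏ i : Fin N, ((i : ℕ).factorial : ℝ) := by
  cases N with
  | zero => simp [sytD]
  | succ m =>
    rw [syt_sf, ← Matrix.det_vandermonde_id_eq_superFactorial (R := ℝ),
      ← Matrix.det_vandermonde_sub _ (m : ℝ), sytD]
    congr 2
    ext i
    have : (i : ℕ) ≤ m := by omega
    simp [sytId, Nat.cast_sub this]

theorem syt_ge {N : ℕ} (l : Fin N → ℕ) (h : StrictAnti l) (i : Fin N) : N - 1 - i ≤ l i := by
  have : ∀ k (i : Fin N), N - 1 - (i : ℕ) = k → k ≤ l i := by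
    intro k
    induction k with
    | zero => intro i _; exact Nat.zero_le _
    | succ k ih =>
      intro i hi
      have h1 := ih ⟨i + 1, by omega⟩ (by simp; omega)
      have h2 := h (show i < ⟨i + 1, by omega⟩ by rw [Fin.lt_def]; simp)
      omega
  exact this _ i rfl

theorem sytId_sum (N : ℕ) : ∑ i, sytId N i = ∑ i : Fin N, (i : ℕ) := by
  refine Fintype.sum_equiv Fin.revPerm _ _ fun i => ?_
  simp only [sytId, Fin.revPerm_apply, Fin.val_rev]
  omega

theorem syt_S0 {N : ℕ} (l : Fin N → ℕ) (h : l ∈ sytS N 0) : l = sytId N := by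
  rw [mem_sytS, zero_add, ← sytId_sum] at h
  have := (Finset.sum_eq_sum_iff_of_le (fun i _ => syt_ge l h.2 i)).1 h.1.symm
  ext i
  exact (this i (Finset.mem_univ i)).symm

theorem syt_Id_mem (N : ℕ) : sytId N ∈ sytS N 0 := by
  rw [mem_sytS, zero_add, sytId_sum]
  refine ⟨rfl, fun i j h => ?_⟩
  simp only [sytId]; rw [Fin.lt_def] at h; omega

theorem sytF_id (N : ℕ) : sytF 0 (sytId N) = 1 := by
  rw [sytF, sytD_id, sytId_fac]
  have hP : (∏ i : Fin N, ((i : ℕ).factorial : ℝ)) ≠ 0 :=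
    Finset.prod_ne_zero_iff.2 fun i _ => by positivity
  simp [hP]

theorem sytG_id (N : ℕ) : sytG (sytId N) = 1 := by
  rw [sytG, sytD_id]
  exact div_self (Finset.prod_ne_zero_iff.2 fun i _ => by positivity)

theorem syt_sum (N n : ℕ) : ∑ l ∈ sytS N n, sytF n l * sytG l = (N : ℝ) ^ n := by
  induction n with
  | zero =>
    have : sytS N 0 = {sytId N} := by
      ext l
      rw [Finset.mem_singleton]
      exact ⟨syt_S0 l, fun h => h ▸ syt_Id_mem N⟩
    rw [this]; simp [sytF_id, sytG_id]
  | succ n ih => rw [syt_step, ih]; ring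

theorem sytF_int (N n : ℕ) : ∀ l ∈ sytS N n, ∃ k : ℤ, (k : ℝ) = sytF n l := by
  induction n with
  | zero => intro l hl; exact ⟨1, by rw [syt_S0 l hl, sytF_id]; simp⟩
  | succ n ih =>
    intro l hl
    rw [mem_sytS] at hl
    have : ∀ i, ∃ k : ℤ, (k : ℝ) =
        if l i = 0 then 0 else sytF n (Function.update l i (l i - 1)) := by
      intro i
      split_ifs with h0
      · exact ⟨0, by simp⟩
      by_cases h : sytD (Function.update l i (l i - 1)) = 0
      · exact ⟨0, by simp [sytF, h]⟩
      · apply ih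
        rw [mem_sytS]
        have := syt_sum_update l i (l i - 1)
        exact ⟨by omega, syt_down l i hl.2 h⟩
    choose k hk using this
    refine ⟨∑ i, k i, ?_⟩
    rw [sytF_rec l hl.1]
    push_cast
    exact Finset.sum_congr rfl fun i _ => hk i

theorem sytG_int {N : ℕ} (l : Fin N → ℕ) : ∃ k : ℤ, (k : ℝ) = sytG l := by
  cases N with
  | zero => exact ⟨1, by simp [sytG, sytD]⟩
  | succ m =>
    obtain ⟨k, hk⟩ := Matrix.superFactorial_dvd_vandermonde_det (fun i => -(l i : ℤ))
    refine ⟨k, ?_⟩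
    have h1 : sytD l = ((Matrix.vandermonde (fun i => -(l i : ℤ))).det : ℝ) := by
      rw [sytD, Matrix.det_vandermonde, Matrix.det_vandermonde]
      push_cast; rfl
    have h2 : (m.superFactorial : ℝ) ≠ 0 := by
      rw [← syt_sf]
      exact Finset.prod_ne_zero_iff.2 fun i _ => by positivity
    rw [sytG, h1, hk, syt_sf]
    push_cast
    field_simp

theorem syt_term {N n : ℕ} (l : Fin N → ℕ) (h : l ∈ sytS N n) :
    ∃ k : ℕ, 0 < k ∧ (k : ℝ) = sytF n l * sytG l := by
  obtain ⟨a, ha⟩ := sytF_int N n l h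
  obtain ⟨b, hb⟩ := sytG_int l
  have hD := sytD_pos l ((mem_sytS l).1 h).2
  have hF : 0 < sytF n l := by
    unfold sytF
    have : 0 < ∏ i, ((l i).factorial : ℝ) := Finset.prod_pos fun i _ => by positivity
    positivity
  have hG : 0 < sytG l := by
    unfold sytG
    have : 0 < ∏ i : Fin N, ((i : ℕ).factorial : ℝ) := Finset.prod_pos fun i _ => by positivity
    positivity
  have hpos : 0 < a * b := by
    have : (0 : ℝ) < ((a * b : ℤ) : ℝ) := by push_cast; rw [ha, hb]; positivity
    exact_mod_cast this
  refine ⟨(a * b).toNat, by omega, ?_⟩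
  rw [← ha, ← hb, ← Int.cast_natCast, Int.toNat_of_nonneg hpos.le]
  push_cast; rfl

theorem syt_fac (n : ℕ) : ∏ x ∈ Finset.Icc 1 n, x = n.factorial := by
  induction n with
  | zero => simp
  | succ n ih => rw [Finset.prod_Icc_succ_top (by omega), ih, Nat.factorial_succ, mul_comm]

theorem syt_hook_row (N : ℕ) (ρ c : ℕ → ℕ) (anti : Antitone ρ) (h0 : ∀ k, N ≤ k → ρ k = 0)
    (hc : ∀ j k, j < ρ k ↔ k < c j) (i : ℕ) (hi : i < N) :
    (∏ j ∈ Finset.range (ρ i), (ρ i - (j + 1) + (c j - (i + 1)) + 1)) *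
      ∏ k ∈ Finset.Ioo i N, (ρ i + k - (ρ k + i)) = (ρ i + (N - 1 - i)).factorial := by
  have hcN : ∀ j, c j ≤ N := by
    intro j
    by_contra h
    push Not at h
    have := (hc j N).2 h
    rw [h0 N le_rfl] at this
    omega
  have hca : ∀ j j', j ≤ j' → c j' ≤ c j := by
    intro j j' h
    by_contra h'
    push Not at h'
    have h1 := (hc j' (c j)).2 h'
    have h2 := (hc j (c j)).1 (by omega)
    omega
  set H : ℕ → ℕ := fun j => ρ i - (j + 1) + (c j - (i + 1)) + 1 with hH
  set G : ℕ → ℕ := fun k => ρ i + k - (ρ k + i) with hG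
  have hHi : Set.InjOn H (Finset.range (ρ i)) := by
    intro a ha b hb hab
    simp only [Finset.coe_range, Set.mem_Iio] at ha hb
    simp only [hH] at hab
    have := (hc a i).1 ha
    have := (hc b i).1 hb
    rcases le_total a b with h | h
    · have := hca _ _ h; omega
    · have := hca _ _ h; omega
  have hGi : Set.InjOn G (Finset.Ioo i N) := by
    intro a ha b hb hab
    simp only [Finset.coe_Ioo, Set.mem_Ioo] at ha hb
    simp only [hG] at hab
    have := anti ha.1.le
    have := anti hb.1.le
    rcases le_total a b with h | h
    · have := anti h; omega
    · have := anti h; omega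
  have hdis : Disjoint ((Finset.range (ρ i)).image H) ((Finset.Ioo i N).image G) := by
    rw [Finset.disjoint_left]
    intro x hx hy
    rw [Finset.mem_image] at hx hy
    obtain ⟨j, hj, rfl⟩ := hx
    obtain ⟨k, hk, hkj⟩ := hy
    simp only [Finset.mem_range, Finset.mem_Ioo] at hj hk
    simp only [hG, hH] at hkj
    have h1 := (hc j i).1 hj
    have h2 := hc j k
    have h3 := anti hk.1.le
    by_cases h : k < c j
    · have := h2.2 h; omega
    · have : ¬ j < ρ k := fun h' => h (h2.1 h')
      omega
  have hsub : (Finset.range (ρ i)).image H ∪ (Finset.Ioo i N).image G ⊆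
      Finset.Icc 1 (ρ i + (N - 1 - i)) := by
    intro x hx
    rw [Finset.mem_union, Finset.mem_image, Finset.mem_image] at hx
    rw [Finset.mem_Icc]
    rcases hx with ⟨j, hj, rfl⟩ | ⟨k, hk, rfl⟩
    · simp only [Finset.mem_range] at hj
      have := hcN j
      simp only [hH]; omega
    · simp only [Finset.mem_Ioo] at hk
      have := anti hk.1.le
      simp only [hG]; omega
  have heq := Finset.eq_of_subset_of_card_le hsub (by
    rw [Finset.card_union_of_disjoint hdis, Finset.card_image_of_injOn hHi,
      Finset.card_image_of_injOn hGi]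
    simp; omega)
  rw [← syt_fac, ← heq, Finset.prod_union hdis,
    Finset.prod_image hHi, Finset.prod_image hGi]

theorem syt_content_row (m r : ℕ) :
    (∏ j ∈ Finset.range r, ((m : ℝ) + 1 + j)) * (m.factorial : ℝ) = ((r + m).factorial : ℝ) := by
  induction r with
  | zero => simp
  | succ r ih =>
    rw [Finset.prod_range_succ, show r + 1 + m = (r + m) + 1 by ring, Nat.factorial_succ]
    push_cast
    rw [← ih]; ring

def sytRho {n : ℕ} (lam : Nat.Partition n) (i : ℕ) : ℕ := rowLen lam (i + 1)

def sytL {n : ℕ} (lam : Nat.Partition n) : List ℕ := (lam.parts.sort (· ≤ ·)).reverse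

theorem sytRho_eq {n : ℕ} (lam : Nat.Partition n) (i : ℕ) :
    sytRho lam i = (sytL lam).getD i 0 := by
  simp [sytRho, rowLen, sytL]

theorem sytL_coe {n : ℕ} (lam : Nat.Partition n) : (sytL lam : Multiset ℕ) = lam.parts := by
  rw [sytL, Multiset.coe_reverse, Multiset.sort_eq]

theorem sytL_length {n : ℕ} (lam : Nat.Partition n) : (sytL lam).length = lam.parts.card := by
  rw [← Multiset.coe_card, sytL_coe]

theorem sytL_pos {n : ℕ} (lam : Nat.Partition n) : ∀ x ∈ sytL lam, 0 < x := by
  intro x hx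
  apply lam.parts_pos
  rw [← sytL_coe]; exact hx

theorem sytL_sorted {n : ℕ} (lam : Nat.Partition n) : (sytL lam).Pairwise (· ≥ ·) := by
  rw [sytL, List.pairwise_reverse]
  exact Multiset.pairwise_sort _ _

theorem sytRho_lt {n : ℕ} (lam : Nat.Partition n) (i : ℕ) (h : i < (sytL lam).length) :
    sytRho lam i = (sytL lam)[i] := by
  rw [sytRho_eq, List.getD_eq_getElem _ _ h]

theorem sytRho_ge {n : ℕ} (lam : Nat.Partition n) (i : ℕ) (h : lam.parts.card ≤ i) :
    sytRho lam i = 0 := by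
  rw [sytRho_eq, List.getD_eq_default]
  rwa [sytL_length]

theorem sytRho_anti {n : ℕ} (lam : Nat.Partition n) : Antitone (sytRho lam) := by
  intro i j hij
  rcases hij.eq_or_lt with rfl | hij
  · exact le_rfl
  by_cases h : j < (sytL lam).length
  · rw [sytRho_lt lam j h, sytRho_lt lam i (hij.trans h)]
    exact (List.pairwise_iff_getElem.1 (sytL_sorted lam)) i j _ _ hij
  · rw [sytRho_ge lam j (by rw [← sytL_length]; omega)]
    exact Nat.zero_le _

theorem syt_list_sum (L : List ℕ) (N : ℕ) (h : L.length ≤ N) :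
    ∑ i ∈ Finset.range N, L.getD i 0 = L.sum := by
  induction L generalizing N with
  | nil => simp
  | cons a L ih =>
    cases N with
    | zero => simp at h
    | succ N =>
      rw [Finset.sum_range_succ']
      simp only [List.getD_cons_succ, List.getD_cons_zero, List.sum_cons]
      rw [ih N (by simpa using h)]; ring

theorem sytRho_sum {n : ℕ} (lam : Nat.Partition n) (N : ℕ) (h : lam.parts.card ≤ N) :
    ∑ i ∈ Finset.range N, sytRho lam i = n := by
  rw [Finset.sum_congr rfl fun i _ => sytRho_eq lam i, syt_list_sum _ _ (by rwa [sytL_length]),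
    ← Multiset.sum_coe, sytL_coe, lam.parts_sum]

theorem syt_card_le {n : ℕ} (lam : Nat.Partition n) : lam.parts.card ≤ n := by
  have := Multiset.card_nsmul_le_sum (s := lam.parts) (a := 1) (fun x hx => lam.parts_pos hx)
  rw [lam.parts_sum] at this
  simpa using this

theorem sytRho_le {n : ℕ} (lam : Nat.Partition n) (i : ℕ) : sytRho lam i ≤ n := by
  by_cases h : i < n
  · refine le_trans ?_ (sytRho_sum lam n (syt_card_le lam)).le
    exact Finset.single_le_sum (f := sytRho lam) (fun _ _ => Nat.zero_le _) (Finset.mem_range.2 h)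
  · rw [sytRho_ge lam i (by have := syt_card_le lam; omega)]; exact Nat.zero_le _

theorem sytRho_inj {n : ℕ} (lam mu : Nat.Partition n) (h : ∀ i, sytRho lam i = sytRho mu i) :
    lam = mu := by
  have key : ∀ (lam mu : Nat.Partition n), (∀ i, sytRho lam i = sytRho mu i) →
      (sytL lam).length ≤ (sytL mu).length := by
    intro lam mu h
    by_contra hlt
    push Not at hlt
    have h1 := h (sytL mu).length
    rw [sytRho_ge mu _ (by rw [sytL_length]), sytRho_lt lam _ hlt] at h1
    have := sytL_pos lam _ (List.getElem_mem hlt)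
    omega
  have hlen := le_antisymm (key lam mu h) (key mu lam fun i => (h i).symm)
  have hL : sytL lam = sytL mu := by
    refine List.ext_getElem hlen fun i h1 h2 => ?_
    rw [← sytRho_lt, ← sytRho_lt, h]
  apply Nat.Partition.ext
  rw [← sytL_coe, ← sytL_coe, hL]

theorem sytRho_surj {n N : ℕ} (ρ : ℕ → ℕ) (anti : Antitone ρ) (h0 : ∀ k, N ≤ k → ρ k = 0)
    (hs : ∑ i ∈ Finset.range N, ρ i = n) :
    ∃ lam : Nat.Partition n, lam.parts.card ≤ N ∧ ∀ i, sytRho lam i = ρ i := by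
  have hex : ∃ m, ρ m = 0 := ⟨N, h0 N le_rfl⟩
  set m := Nat.find hex with hm
  have hmN : m ≤ N := Nat.find_min' hex (h0 N le_rfl)
  have hm0 : ∀ k, m ≤ k → ρ k = 0 := by
    intro k hk
    have := anti hk
    have h2 : ρ m = 0 := Nat.find_spec hex
    omega
  have hm1 : ∀ k, k < m → 0 < ρ k := fun k hk => Nat.pos_of_ne_zero (Nat.find_min hex hk)
  set L := (List.range m).map ρ with hL
  let lam : Nat.Partition n :=
    { parts := (L : Multiset ℕ)
      parts_pos := by
        intro x hx
        rw [Multiset.mem_coe, hL, List.mem_map] at hx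
        obtain ⟨k, hk, rfl⟩ := hx
        exact hm1 k (List.mem_range.1 hk)
      parts_sum := by
        rw [Multiset.sum_coe, hL, ← hs, ← Finset.sum_subset (Finset.range_subset_range.2 hmN)]
        · rfl
        · intro k _ hk
          exact hm0 k (by simpa using hk) }
  refine ⟨lam, ?_, ?_⟩
  · change Multiset.card (L : Multiset ℕ) ≤ N
    simpa [hL] using hmN
  · have hLL : sytL lam = L := by
      have hp : (sytL lam).Perm L := Multiset.coe_eq_coe.1 (sytL_coe lam)
      refine hp.eq_of_pairwise' (r := (· ≥ ·)) (sytL_sorted lam) ?_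
      rw [hL, List.pairwise_map]
      exact List.pairwise_lt_range.imp fun h => anti h.le
    intro i
    rw [sytRho_eq, hLL]
    by_cases h : i < m
    · rw [List.getD_eq_getElem _ _ (by simpa [hL] using h)]
      simp [hL]
    · rw [List.getD_eq_default _ _ (by simpa [hL] using h), hm0 i (by omega)]

theorem syt_cells_prod {n : ℕ} (lam : Nat.Partition n) (N : ℕ) (h : lam.parts.card ≤ N)
    (F : ℕ × ℕ → ℝ) :
    ∏ p ∈ cellsOf lam, F p =
      ∏ i ∈ Finset.range N, ∏ j ∈ Finset.range (sytRho lam i), F (i + 1, j + 1) := by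
  rw [Finset.prod_sigma']
  symm
  refine Finset.prod_bij (fun p _ => (p.1 + 1, p.2 + 1)) ?_ ?_ ?_ ?_
  · rintro ⟨i, j⟩ hp
    simp only [Finset.mem_sigma, Finset.mem_range] at hp
    simp only [cellsOf, Finset.mem_filter, Finset.mem_product, Finset.mem_Icc]
    have h1 := sytRho_le lam i
    have h2 : i < n := by
      by_contra hn
      have := sytRho_ge lam i (by have := syt_card_le lam; omega)
      omega
    have h3 : sytRho lam i = rowLen lam (i + 1) := rfl
    omega
  · rintro ⟨i, j⟩ _ ⟨i', j'⟩ _ h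
    simp only [Prod.mk.injEq, Nat.add_right_cancel_iff] at h
    obtain ⟨rfl, rfl⟩ := h
    rfl
  · rintro ⟨i, j⟩ hp
    simp only [cellsOf, Finset.mem_filter, Finset.mem_product, Finset.mem_Icc] at hp
    have hi : i - 1 + 1 = i := by omega
    have hj : j - 1 + 1 = j := by omega
    have h3 : sytRho lam (i - 1) = rowLen lam i := by rw [sytRho, hi]
    refine ⟨⟨i - 1, j - 1⟩, ?_, by simp [hi, hj]⟩
    simp only [Finset.mem_sigma, Finset.mem_range]
    constructor
    · by_contra hN
      have := sytRho_ge lam (i - 1) (by omega)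
      omega
    · omega
  · intros; rfl

theorem syt_colLen {n : ℕ} (lam : Nat.Partition n) (j k : ℕ) :
    j < sytRho lam k ↔ k < colLen lam (j + 1) := by
  have hex : ∃ m, sytRho lam m ≤ j := ⟨n, by rw [sytRho_ge lam n (syt_card_le lam)]; omega⟩
  have hc : colLen lam (j + 1) = Nat.find hex := by
    have hmn : Nat.find hex ≤ n :=
      Nat.find_min' hex (by rw [sytRho_ge lam n (syt_card_le lam)]; omega)
    have : (Finset.Icc 1 n).filter (fun i => j + 1 ≤ rowLen lam i) =
        Finset.Icc 1 (Nat.find hex) := by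
      ext i
      simp only [Finset.mem_filter, Finset.mem_Icc]
      constructor
      · rintro ⟨h1, h2⟩
        refine ⟨h1.1, ?_⟩
        by_contra hlt
        have h3 := sytRho_anti lam (show Nat.find hex ≤ i - 1 by omega)
        have h4 := Nat.find_spec hex
        have h5 : sytRho lam (i - 1) = rowLen lam i := by
          rw [sytRho, show i - 1 + 1 = i by omega]
        omega
      · rintro ⟨h1, h2⟩
        have h4 := Nat.find_min hex (show i - 1 < Nat.find hex by omega)
        have h5 : sytRho lam (i - 1) = rowLen lam i := by
          rw [sytRho, show i - 1 + 1 = i by omega]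
        omega
    rw [colLen, this]; simp
  rw [hc]
  constructor
  · intro h
    by_contra hlt
    have h3 := sytRho_anti lam (show Nat.find hex ≤ k by omega)
    have h4 := Nat.find_spec hex
    omega
  · intro h
    have := Nat.find_min hex h
    omega

def sytl {n : ℕ} (N : ℕ) (lam : Nat.Partition n) : Fin N → ℕ :=
  fun i => sytRho lam i + (N - 1 - i)

theorem sytl_mem {n N : ℕ} (lam : Nat.Partition n) (h : lam.parts.card ≤ N) :
    sytl N lam ∈ sytS N n := by
  rw [mem_sytS]
  constructor
  · simp only [sytl]
    rw [Finset.sum_add_distrib, Fin.sum_univ_eq_sum_range (sytRho lam), sytRho_sum lam N h]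
    congr 1
    exact sytId_sum N
  · intro i j hij
    have := sytRho_anti lam (show (i : ℕ) ≤ j from hij.le)
    have h2 : (i : ℕ) < j := hij
    simp only [sytl]; omega

theorem syt_hook_prod {n N : ℕ} (lam : Nat.Partition n) (h : lam.parts.card ≤ N) :
    (∏ p ∈ cellsOf lam, (hookLen lam p.1 p.2 : ℝ)) * sytD (sytl N lam) =
      ∏ i, ((sytl N lam i).factorial : ℝ) := by
  rw [syt_cells_prod lam N h, sytD_prod, ← Fin.prod_univ_eq_prod_range (fun i =>
    ∏ j ∈ Finset.range (sytRho lam i), (hookLen lam (i + 1) (j + 1) : ℝ)), ← Finset.prod_mul_distrib]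
  refine Finset.prod_congr rfl fun i _ => ?_
  have key := syt_hook_row N (sytRho lam) (fun j => colLen lam (j + 1)) (sytRho_anti lam)
    (fun k hk => sytRho_ge lam k (h.trans hk)) (syt_colLen lam) i i.2
  have e : ∏ j ∈ Finset.Ioi i, ((sytl N lam i : ℝ) - sytl N lam j) =
      ((∏ k ∈ Finset.Ioo (i : ℕ) N, (sytRho lam i + k - (sytRho lam k + i)) : ℕ) : ℝ) := by
    rw [Nat.cast_prod]
    refine Finset.prod_bij (fun k _ => (k : ℕ)) ?_ ?_ ?_ ?_
    · intro k hk
      rw [Finset.mem_Ioi] at hk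
      exact Finset.mem_Ioo.2 ⟨hk, k.2⟩
    · intro a _ b _ hab
      exact Fin.ext hab
    · intro b hb
      rw [Finset.mem_Ioo] at hb
      exact ⟨⟨b, hb.2⟩, Finset.mem_Ioi.2 hb.1, rfl⟩
    · intro k hk
      rw [Finset.mem_Ioi] at hk
      have h2 : (i : ℕ) < k := hk
      have h1 := sytRho_anti lam h2.le
      have h3 := k.2
      rw [← Nat.cast_sub (by simp only [sytl]; omega)]
      congr 1
      simp only [sytl]; omega
  rw [e]
  simp only [sytl]
  rw [← key]
  push_cast
  congr 1
  refine Finset.prod_congr rfl fun j _ => ?_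
  simp only [hookLen, sytRho]
  push_cast
  rfl

theorem syt_content_prod {n N : ℕ} (lam : Nat.Partition n) (h : lam.parts.card ≤ N) :
    (∏ p ∈ cellsOf lam, ((N : ℝ) + (p.2 : ℝ) - (p.1 : ℝ))) * ∏ i : Fin N, ((i : ℕ).factorial : ℝ) =
      ∏ i, ((sytl N lam i).factorial : ℝ) := by
  rw [syt_cells_prod lam N h, ← sytId_fac, ← Fin.prod_univ_eq_prod_range (fun i =>
    ∏ j ∈ Finset.range (sytRho lam i), ((N : ℝ) + ((i + 1, j + 1) : ℕ × ℕ).2 -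
      ((i + 1, j + 1) : ℕ × ℕ).1)), ← Finset.prod_mul_distrib]
  refine Finset.prod_congr rfl fun i _ => ?_
  simp only [sytl, sytId]
  rw [← syt_content_row]
  congr 1
  refine Finset.prod_congr rfl fun j _ => ?_
  have : N = (N - 1 - i) + 1 + i := by omega
  have h2 : (N : ℝ) = ((N - 1 - i : ℕ) : ℝ) + 1 + i := by exact_mod_cast this
  push_cast
  linarith

theorem syt_dimE {n N : ℕ} (lam : Nat.Partition n) (h : lam.parts.card ≤ N) :
    dimE n N lam = sytF n (sytl N lam) * sytG (sytl N lam) := by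
  have h1 := syt_hook_prod lam h
  have h2 := syt_content_prod lam h
  have hD := (sytD_pos _ ((mem_sytS _).1 (sytl_mem lam h)).2).ne'
  have hS : (∏ i : Fin N, ((i : ℕ).factorial : ℝ)) ≠ 0 :=
    Finset.prod_ne_zero_iff.2 fun i _ => by positivity
  have hP : (∏ i, ((sytl N lam i).factorial : ℝ)) ≠ 0 :=
    Finset.prod_ne_zero_iff.2 fun i _ => by positivity
  rw [← eq_div_iff hD] at h1
  rw [← eq_div_iff hS] at h2
  rw [dimE, h1, h2, sytF, sytG]
  field_simp

theorem syt_total (n N : ℕ) : ∑ lam ∈ YNN n N, dimE n N lam = (N : ℝ) ^ n := by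
  rw [← syt_sum N n]
  refine Finset.sum_bij (fun lam _ => sytl N lam) ?_ ?_ ?_ ?_
  · intro lam hl
    exact sytl_mem lam (by simpa [YNN] using hl)
  · intro lam hl mu hm h
    have hl' : lam.parts.card ≤ N := by simpa [YNN] using hl
    have hm' : mu.parts.card ≤ N := by simpa [YNN] using hm
    apply sytRho_inj
    intro i
    by_cases hi : i < N
    · have := congrFun h ⟨i, hi⟩
      simpa [sytl] using this
    · rw [sytRho_ge lam i (by omega), sytRho_ge mu i (by omega)]
  · intro l hl
    rw [mem_sytS] at hl
    set ρ : ℕ → ℕ := fun k => if hk : k < N then l ⟨k, hk⟩ - (N - 1 - k) else 0 with hρ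
    have hlρ : ∀ i : Fin N, l i = ρ i + (N - 1 - i) := by
      intro i
      have := syt_ge l hl.2 i
      simp only [hρ, i.2, dif_pos, Fin.eta]
      omega
    have anti : Antitone ρ := by
      refine antitone_nat_of_succ_le fun k => ?_
      by_cases hk : k + 1 < N
      · have h1 := hlρ ⟨k, by omega⟩
        have h2 := hlρ ⟨k + 1, hk⟩
        have h3 := hl.2 (show (⟨k, by omega⟩ : Fin N) < ⟨k + 1, hk⟩ by rw [Fin.lt_def]; simp)
        simp only at h1 h2
        omega
      · simp [hρ, hk]
    have h0 : ∀ k, N ≤ k → ρ k = 0 := fun k hk => by simp [hρ, hk]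
    have hs : ∑ i ∈ Finset.range N, ρ i = n := by
      have h1 := hl.1
      rw [Finset.sum_congr rfl fun i _ => hlρ i, Finset.sum_add_distrib,
        Fin.sum_univ_eq_sum_range ρ, ← sytId_sum] at h1
      exact Nat.add_right_cancel h1
    obtain ⟨lam, h1, h2⟩ := sytRho_surj ρ anti h0 hs
    refine ⟨lam, by simpa [YNN] using h1, ?_⟩
    ext i
    rw [hlρ i, ← h2]; rfl
  · intro lam hl
    exact syt_dimE lam (by simpa [YNN] using hl)

/-- For positive integers `n, N`:
`N^n = Σ_{λ ∈ 𝕐_N^n} n!·∏(N+c_{i,j})/(∏ h_{i,j})²`; each summand is a positive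
integer; and `λ ↦ dim E_λ / N^n` is a probability distribution on `𝕐_N^n`. -/
theorem sum_dim_isotypic_eq_pow :
    ∀ n N : ℕ, 0 < n → 0 < N →
      ((N : ℝ)^n = ∑ lam ∈ YNN n N, dimE n N lam) ∧
      (∀ lam ∈ YNN n N, ∃ k : ℕ, 0 < k ∧ (k : ℝ) = dimE n N lam) ∧
      (∀ lam ∈ YNN n N, 0 ≤ PNN n N lam) ∧
      (∑ lam ∈ YNN n N, PNN n N lam = 1) := by
  intro n N hn hN
  have hpos : ∀ lam ∈ YNN n N, ∃ k : ℕ, 0 < k ∧ (k : ℝ) = dimE n N lam := by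
    intro lam hl
    have hl' : lam.parts.card ≤ N := by simpa [YNN] using hl
    rw [syt_dimE lam hl']
    exact syt_term _ (sytl_mem lam hl')
  refine ⟨(syt_total n N).symm, hpos, ?_, ?_⟩
  · intro lam hl
    obtain ⟨k, _, hk⟩ := hpos lam hl
    rw [PNN, ← hk]
    positivity
  · simp only [PNN]
    rw [← Finset.sum_div, syt_total]
    have : (N : ℝ) ≠ 0 := by positivity
    exact div_self (pow_ne_zero _ this)
end
end
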